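/- Under hypotheses (H0)-(H4), for every a ∈ ∂D̂ (i.e. a ∈ D̂ with max{φ(a), φ₀(ā)} = 1), the normal cone V(a) to D̂ at a equals: {c₁∇φ(a) + c₂(∇φ₀(ā) + κ_{ā}∇φ(ā)) : c₁,c₂ ≥ 0} if φ(a) = φ₀(ā) = 1 and a ∉ ∂₀D; {c(∇φ₀(ā) + κ_{ā}∇φ(ā)) : c ≥ 0} if φ(a) < φ₀(ā) = 1 and a ∉ ∂₀D; and {c∇φ(a) : c ≥ 0} if either a ∈ ∂₀D or φ₀(ā) < φ(a) = 1; here κ_a := −(∂φ₀/∂β)(a)·((∂φ/∂β)(a))^{−1}, with ∂/∂β the partial derivative in the last coordinate. -/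

import Mathlib

open scoped ENNReal
open Filter MeasureTheory

namespace ReflectedRW

/-- `ℤ^d` realized as `ℤ^{d-1} × ℤ`. -/
abbrev Zd (d : ℕ) := (Fin (d-1) → ℤ) × ℤ
/-- `ℝ^d` realized as `ℝ^{d-1} × ℝ`. -/
abbrev Rd (d : ℕ) := (Fin (d-1) → ℝ) × ℝ
/-- The state space `ℤ^{d-1} × ℕ` of the reflected walk. -/
abbrev St (d : ℕ) := (Fin (d-1) → ℤ) × ℕ

/-- Embedding of the state space into `ℤ^d`. -/
def toZ (d : ℕ) (z : St d) : Zd d := (z.1, (z.2 : ℤ))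

/-- Embedding of `ℤ^d` into `ℝ^d`. -/
def toR (d : ℕ) (z : Zd d) : Rd d := (fun i => (z.1 i : ℝ), (z.2 : ℝ))

/-- Scalar product `a · z` of `a ∈ ℝ^d` and `z ∈ ℤ^d`. -/
noncomputable def dotZ (d : ℕ) (a : Rd d) (z : Zd d) : ℝ :=
  (∑ i, a.1 i * (z.1 i : ℝ)) + a.2 * (z.2 : ℝ)

/-- Scalar product on `ℝ^d`. -/
noncomputable def dotR (d : ℕ) (a q : Rd d) : ℝ :=
  (∑ i, a.1 i * q.1 i) + a.2 * q.2

/-- One-step transition probabilities of the reflected random walk `Z(t)`: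
jumps with law `μ` in the interior and with law `μ0` on the boundary `y = 0`. -/
noncomputable def step (d : ℕ) (μ μ0 : Zd d → ℝ) (z z' : St d) : ℝ≥0∞ :=
  if z.2 = 0 then ENNReal.ofReal (μ0 (toZ d z' - toZ d z))
  else ENNReal.ofReal (μ (toZ d z' - toZ d z))

/-- Real-valued version of the transition kernel of `Z(t)`. -/
noncomputable def stepR (d : ℕ) (μ μ0 : Zd d → ℝ) (z z' : St d) : ℝ :=
  if z.2 = 0 then μ0 (toZ d z' - toZ d z) else μ (toZ d z' - toZ d z)

/-- `n`-step kernel obtained by iterating a sub-Markov kernel `p`. -/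
noncomputable def kerIter {S : Type*} [DecidableEq S] (p : S → S → ℝ≥0∞) :
    ℕ → S → S → ℝ≥0∞
  | 0, z, z' => if z = z' then 1 else 0
  | n+1, z, z' => ∑' w : S, kerIter p n z w * p w z'

/-- `n`-step transition probabilities of `Z(t)`: `P_z(Z(n) = z')`. -/
noncomputable def stepn (d : ℕ) (μ μ0 : Zd d → ℝ) : ℕ → St d → St d → ℝ≥0∞ :=
  kerIter (step d μ μ0)

/-- Green's function `G(z,z') = ∑_{t ≥ 0} P_z(Z(t) = z')` of the reflected walk. -/
noncomputable def green (d : ℕ) (μ μ0 : Zd d → ℝ) (z z' : St d) : ℝ≥0∞ :=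
  ∑' n : ℕ, stepn d μ μ0 n z z'

/-- Kernel of the walk killed upon hitting the boundary hyperplane `y = 0`. -/
noncomputable def stepKilled (d : ℕ) (μ μ0 : Zd d → ℝ) (z z' : St d) : ℝ≥0∞ :=
  if z'.2 = 0 then 0 else step d μ μ0 z z'

/-- `n`-step kernel of the killed walk: `P_z(Z(n) = z', τ > n)` where
`τ` is the first return time to the boundary hyperplane. -/
noncomputable def stepKilledn (d : ℕ) (μ μ0 : Zd d → ℝ) : ℕ → St d → St d → ℝ≥0∞ :=
  kerIter (stepKilled d μ μ0)

/-- Green's function `G₊(z,z')` of the killed walk. -/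
noncomputable def greenPlus (d : ℕ) (μ μ0 : Zd d → ℝ) (z z' : St d) : ℝ≥0∞ :=
  ∑' n : ℕ, stepKilledn d μ μ0 n z z'

/-- One-step kernel of the homogeneous random walk `S(t)` on `ℤ^d`. -/
noncomputable def stepS (d : ℕ) (μ : Zd d → ℝ) (z z' : Zd d) : ℝ≥0∞ :=
  ENNReal.ofReal (μ (z' - z))

/-- `n`-step kernel of the homogeneous random walk on `ℤ^d`. -/
noncomputable def stepSn (d : ℕ) (μ : Zd d → ℝ) : ℕ → Zd d → Zd d → ℝ≥0∞ :=
  kerIter (stepS d μ)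

/-- Green's function `G_S` of the homogeneous random walk on `ℤ^d`. -/
noncomputable def greenS (d : ℕ) (μ : Zd d → ℝ) (z z' : Zd d) : ℝ≥0∞ :=
  ∑' n : ℕ, stepSn d μ n z z'

/-- `hitProb z w = P_z(τ < ∞, Z(τ) = w)`, the hitting distribution on the boundary
hyperplane, `τ = inf{t ≥ 1 : Z(t) ∈ ℤ^{d-1}×{0}}`. -/
noncomputable def hitProb (d : ℕ) (μ μ0 : Zd d → ℝ) (z w : St d) : ℝ≥0∞ :=
  if w.2 = 0 then
    ∑' n : ℕ, ∑' v : St d, stepKilledn d μ μ0 n z v * step d μ μ0 v w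
  else 0

/-- The jump generating function `φ(a) = ∑_z μ(z) e^{a·z}`. -/
noncomputable def jgf (d : ℕ) (μ : Zd d → ℝ) (a : Rd d) : ℝ :=
  ∑' z : Zd d, μ z * Real.exp (dotZ d a z)

/-- Partial derivative `∂φ/∂β` of the jump generating function in the last coordinate. -/
noncomputable def jgfDβ (d : ℕ) (μ : Zd d → ℝ) (a : Rd d) : ℝ :=
  ∑' z : Zd d, μ z * (z.2 : ℝ) * Real.exp (dotZ d a z)

/-- Gradient `∇φ(a)` of the jump generating function. -/
noncomputable def jgfGrad (d : ℕ) (μ : Zd d → ℝ) (a : Rd d) : Rd d :=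
  (fun i => ∑' z : Zd d, μ z * (z.1 i : ℝ) * Real.exp (dotZ d a z), jgfDβ d μ a)

/-- The set `D = {a : φ(a) ≤ 1}`. -/
def Dset (d : ℕ) (μ : Zd d → ℝ) : Set (Rd d) := {a | jgf d μ a ≤ 1}

/-- `∂₊D`: points of the boundary of `D` where the last coordinate of `∇φ` is `≥ 0`. -/
def bdPlus (d : ℕ) (μ : Zd d → ℝ) : Set (Rd d) :=
  {a | jgf d μ a = 1 ∧ 0 ≤ jgfDβ d μ a}

/-- `∂₋D`: points of the boundary of `D` where the last coordinate of `∇φ` is `≤ 0`. -/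
def bdMinus (d : ℕ) (μ : Zd d → ℝ) : Set (Rd d) :=
  {a | jgf d μ a = 1 ∧ jgfDβ d μ a ≤ 0}

/-- `∂₀D`: points of the boundary of `D` where the last coordinate of `∇φ` is `0`. -/
def bdZero (d : ℕ) (μ : Zd d → ℝ) : Set (Rd d) :=
  {a | jgf d μ a = 1 ∧ jgfDβ d μ a = 0}

/-- `Θ = {α ∈ ℝ^{d-1} : inf_β max(φ(α,β), φ₀(α,β)) ≤ 1}`. -/
noncomputable def Theta (d : ℕ) (μ μ0 : Zd d → ℝ) : Set (Fin (d-1) → ℝ) :=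
  {α | (⨅ β : ℝ, max (jgf d μ (α, β)) (jgf d μ0 (α, β))) ≤ 1}

/-- `D̂ = (Θ×ℝ) ∩ D`. -/
noncomputable def Dhat (d : ℕ) (μ μ0 : Zd d → ℝ) : Set (Rd d) :=
  {a | a.1 ∈ Theta d μ μ0 ∧ jgf d μ a ≤ 1}

/-- Normal cone to a convex set `s ⊆ ℝ^d` at the point `a`. -/
noncomputable def normalCone (d : ℕ) (s : Set (Rd d)) (a : Rd d) : Set (Rd d) :=
  {q | ∀ b ∈ s, dotR d q (b - a) ≤ 0}

/-- The mean vector `m = ∑_z z μ(z)`. -/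
noncomputable def meanVec (d : ℕ) (μ : Zd d → ℝ) : Rd d :=
  (fun i => ∑' z : Zd d, μ z * (z.1 i : ℝ), ∑' z : Zd d, μ z * (z.2 : ℝ))

/-- The harmonic functions `h_a` of (1-8), for `a ∈ D̂ ∩ ∂₊D` with associated
point `abar = ā ∈ ∂₋D` (same first `d-1` coordinates as `a`). -/
noncomputable def hfun (d : ℕ) (μ μ0 : Zd d → ℝ) (a abar : Rd d) (z : St d) : ℝ :=
  if jgf d μ0 abar = 1 then Real.exp (dotZ d abar (toZ d z))
  else if a = abar then
    (z.2 : ℝ) * Real.exp (dotZ d a (toZ d z))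
      + (jgfDβ d μ0 a / (1 - jgf d μ0 a)) * Real.exp (dotZ d a (toZ d z))
  else
    Real.exp (dotZ d a (toZ d z))
      - ((1 - jgf d μ0 a) / (1 - jgf d μ0 abar)) * Real.exp (dotZ d abar (toZ d z))

/-- `h : ℤ^{d-1}×ℕ → ℝ` is harmonic for the reflected walk. -/
def IsHarmonic (d : ℕ) (μ μ0 : Zd d → ℝ) (h : St d → ℝ) : Prop :=
  ∀ z : St d, HasSum (fun z' => stepR d μ μ0 z z' * h z') (h z)

/-- Minimal nonnegative harmonic function. -/
def IsMinimalHarmonic (d : ℕ) (μ μ0 : Zd d → ℝ) (h : St d → ℝ) : Prop :=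
  IsHarmonic d μ μ0 h ∧ (∀ z, 0 ≤ h z) ∧ h ≠ 0 ∧
    ∀ h' : St d → ℝ, IsHarmonic d μ μ0 h' → (∀ z, 0 ≤ h' z) → h' ≠ 0 →
      (∀ z, h' z ≤ h z) → ∃ c : ℝ, 0 < c ∧ h' = fun z => c * h z

/- Hypotheses (H0)–(H4). -/

/-- `(H0)`: `μ(x,y) = 0` for `y < -1` and `μ₀(x,y) = 0` for `y < 0`. -/
def H0 (d : ℕ) (μ μ0 : Zd d → ℝ) : Prop :=
  (∀ z : Zd d, z.2 < -1 → μ z = 0) ∧ (∀ z : Zd d, z.2 < 0 → μ0 z = 0)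

/-- `(H1)`: the reflected walk is irreducible on `ℤ^{d-1}×ℕ`. -/
def H1 (d : ℕ) (μ μ0 : Zd d → ℝ) : Prop :=
  ∀ z z' : St d, ∃ n : ℕ, 0 < stepn d μ μ0 n z z'

/-- `(H2)`: the homogeneous walk with step law `μ` is irreducible on `ℤ^d` and its
last coordinate is an aperiodic random walk on `ℤ`. -/
def H2 (d : ℕ) (μ : Zd d → ℝ) : Prop :=
  (∀ z z' : Zd d, ∃ n : ℕ, 0 < stepSn d μ n z z') ∧
    AddSubgroup.closure {y : ℤ | ∃ x : Fin (d-1) → ℤ, μ (x, y) ≠ 0} = ⊤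

/-- `(H3)`: `m ≠ 0` and `m/|m| + m₀/|m₀| ≠ 0`. -/
noncomputable def H3 (d : ℕ) (μ μ0 : Zd d → ℝ) : Prop :=
  meanVec d μ ≠ 0 ∧ meanVec d μ0 ≠ 0 ∧
    ‖meanVec d μ‖⁻¹ • meanVec d μ + ‖meanVec d μ0‖⁻¹ • meanVec d μ0 ≠ 0

/-- `(H4)`: the jump generating functions are finite everywhere on `ℝ^d`. -/
def H4 (d : ℕ) (μ μ0 : Zd d → ℝ) : Prop :=
  ∀ a : Rd d, Summable (fun z : Zd d => μ z * Real.exp (dotZ d a z)) ∧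
    Summable (fun z : Zd d => μ0 z * Real.exp (dotZ d a z))

/-- `μ` is a probability distribution on `ℤ^d`. -/
def IsProb (d : ℕ) (μ : Zd d → ℝ) : Prop :=
  (∀ z : Zd d, 0 ≤ μ z) ∧ HasSum μ 1


open Topology

/-- Gordan's theorem of the alternative: finitely many linear functionals without a common
strictly negative direction satisfy a nontrivial nonnegative linear relation. -/
lemma exists_nonneg_relation {E ι : Type*} [AddCommGroup E] [Module ℝ E] [Fintype ι]
    (L : ι → E →ₗ[ℝ] ℝ) (h : ¬ ∃ v, ∀ i, L i v < 0) :
    ∃ l : ι → ℝ, (∀ i, 0 ≤ l i) ∧ l ≠ 0 ∧ ∀ v, ∑ i, l i * L i v = 0 := by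
  classical
  let T : E →ₗ[ℝ] (ι → ℝ) := LinearMap.pi L
  let O : Set (ι → ℝ) := Set.pi Set.univ fun _ => Set.Iio 0
  have hOc : Convex ℝ O := convex_pi fun _ _ => convex_Iio 0
  have hOo : IsOpen O := isOpen_set_pi Set.finite_univ fun _ _ => isOpen_Iio
  have hTc : Convex ℝ (LinearMap.range T : Set (ι → ℝ)) := (LinearMap.range T).convex
  have hdisj : Disjoint O (LinearMap.range T : Set (ι → ℝ)) := by
    rw [Set.disjoint_left]
    rintro u hu ⟨v, rfl⟩
    exact h ⟨v, fun i => hu i (Set.mem_univ i)⟩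
  obtain ⟨f, u, hfO, hfT⟩ := geometric_hahn_banach_open hOc hOo hTc hdisj
  have hu0 : u ≤ 0 := by simpa using hfT 0 (zero_mem _)
  have hfT0 : ∀ v, f (T v) = 0 := by
    intro v
    by_contra hne
    have h1 := hfT (T (((u - 1) / f (T v)) • v)) ⟨_, rfl⟩
    rw [map_smul, map_smul, smul_eq_mul, div_mul_cancel₀ _ hne] at h1
    linarith
  have hf : ∀ w : ι → ℝ, f w = ∑ i, f (Pi.single i 1) * w i := by
    intro w
    conv_lhs => rw [← Finset.univ_sum_single w]
    rw [map_sum]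
    refine Finset.sum_congr rfl fun i _ => ?_
    rw [show (Pi.single i (w i) : ι → ℝ) = w i • Pi.single i 1 by
      rw [← Pi.single_smul]; simp, map_smul, smul_eq_mul, mul_comm]
  have hneg : ∀ w ∈ O, f w < 0 := fun w hw => (hfO w hw).trans_le hu0
  have hone : (fun _ => -1 : ι → ℝ) ∈ O := fun i _ => by simp
  refine ⟨fun i => f (Pi.single i 1), fun i => ?_, fun h0 => ?_, fun v => ?_⟩
  · by_contra hlt
    push Not at hlt
    set s : ℝ := f (fun _ => -1) / f (Pi.single i 1) with hs
    have hs0 : 0 < s := div_pos_of_neg_of_neg (hneg _ hone) hlt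
    have hmem : (fun _ => -1 : ι → ℝ) - s • Pi.single i 1 ∈ O := by
      intro j _
      by_cases hj : j = i
      · subst hj; simp; linarith
      · simp [hj]
    have h2 := hneg _ hmem
    rw [map_sub, map_smul, smul_eq_mul, hs, div_mul_cancel₀ _ hlt.ne] at h2
    linarith
  · have h1 := hneg _ hone
    rw [hf] at h1
    have h2 : ∀ i, f (Pi.single i 1) = 0 := fun i => congrFun h0 i
    simp [h2] at h1
  · rw [← hfT0 v, hf]
    rfl

/-- Karush–Kuhn–Tucker multipliers for a linear objective `c` that is maximal at `x` under the
constraints `F i ≤ 1`, with subgradients `L i` at `x` and a Slater point `s`. -/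
lemma exists_multipliers {E ι : Type*} [AddCommGroup E] [Module ℝ E] [Fintype ι]
    (F : ι → E → ℝ) (L : ι → E →ₗ[ℝ] ℝ) (c : E →ₗ[ℝ] ℝ) (x s : E)
    (hx : ∀ i, F i x ≤ 1) (hs : ∀ i, F i s < 1)
    (hsub : ∀ i, F i x + L i (s - x) ≤ F i s)
    (hup : ∀ i v, ∃ C, ∀ t : ℝ, |t| ≤ 1 → F i (x + t • v) ≤ F i x + t * L i v + C * t ^ 2)
    (hc : ∀ y, (∀ i, F i y ≤ 1) → c (y - x) ≤ 0) :
    ∃ l : ι → ℝ, (∀ i, 0 ≤ l i) ∧ (∀ i, F i x < 1 → l i = 0) ∧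
      ∀ v, c v = ∑ i, l i * L i v := by
  let M : Option (Option ι) → E × ℝ →ₗ[ℝ] ℝ := fun o => match o with
    | none => -(c ∘ₗ LinearMap.fst ℝ E ℝ)
    | some none => -LinearMap.snd ℝ E ℝ
    | some (some i) => L i ∘ₗ LinearMap.fst ℝ E ℝ - (1 - F i x) • LinearMap.snd ℝ E ℝ
  have hM : ¬ ∃ v, ∀ i, M i v < 0 := by
    rintro ⟨⟨v, r⟩, hv⟩
    have hcv : 0 < c v := by simpa [M] using hv none
    have hr : 0 < r := by simpa [M] using hv (some none)
    have hL : ∀ i, L i v < (1 - F i x) * r := fun i => by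
      simpa [M] using hv (some (some i))
    have hev : ∀ᶠ t : ℝ in 𝓝[>] 0, ∀ i, F i (x + t • v) ≤ 1 := by
      rw [Filter.eventually_all]
      intro i
      obtain ⟨C, hC⟩ := hup i v
      have h1 : ∀ᶠ t : ℝ in 𝓝[>] 0, t < 1 :=
        (eventually_lt_nhds one_pos).filter_mono nhdsWithin_le_nhds
      have h2 : ∀ᶠ t : ℝ in 𝓝[>] 0, t * r < 1 := by
        have : Tendsto (fun t : ℝ => t * r) (𝓝[>] 0) (𝓝 0) := by
          have : ContinuousAt (fun t : ℝ => t * r) 0 := by fun_prop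
          simpa using this.tendsto.mono_left nhdsWithin_le_nhds
        exact this.eventually (Iio_mem_nhds one_pos)
      have h3 : ∀ᶠ t : ℝ in 𝓝[>] 0, C * t < (1 - F i x) * r - L i v := by
        have : Tendsto (fun t : ℝ => C * t) (𝓝[>] 0) (𝓝 0) := by
          have : ContinuousAt (fun t : ℝ => C * t) 0 := by fun_prop
          simpa using this.tendsto.mono_left nhdsWithin_le_nhds
        exact this.eventually (Iio_mem_nhds (sub_pos.2 (hL i)))
      filter_upwards [h1, h2, h3, self_mem_nhdsWithin] with t h1 h2 h3 h0
      have h0 : 0 < t := h0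
      have h4 := hC t (abs_le.2 ⟨by linarith, h1.le⟩)
      have h5 := mul_lt_mul_of_pos_left h3 h0
      have h6 := mul_nonneg (sub_nonneg.2 (hx i)) (sub_nonneg.2 h2.le)
      nlinarith
    obtain ⟨t, ht, h0⟩ := (hev.and self_mem_nhdsWithin).exists
    have h0 : 0 < t := h0
    have h1 := hc _ ht
    rw [add_sub_cancel_left, map_smul, smul_eq_mul] at h1
    exact absurd (mul_pos h0 hcv) (not_lt.2 h1)
  obtain ⟨l, hl0, hlne, hl⟩ := exists_nonneg_relation M hM
  have hrel : ∀ v, ∑ i, l (some (some i)) * L i v = l none * c v := by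
    intro v
    have := hl (v, 0)
    simp only [Fintype.sum_option, M] at this
    simp at this
    linarith
  have hcomp : l (some none) + ∑ i, l (some (some i)) * (1 - F i x) = 0 := by
    have := hl (0, 1)
    simp only [Fintype.sum_option, M] at this
    simp at this
    simp only [mul_sub, mul_one, Finset.sum_sub_distrib] at this ⊢
    linarith
  have hnn : ∀ i, 0 ≤ l (some (some i)) * (1 - F i x) := fun i =>
    mul_nonneg (hl0 _) (sub_nonneg.2 (hx i))
  have hr0 : l (some none) = 0 :=
    le_antisymm (by linarith [Finset.sum_nonneg fun i (_ : i ∈ Finset.univ) => hnn i]) (hl0 _)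
  have hcomp' : ∀ i, l (some (some i)) * (1 - F i x) = 0 := by
    rw [hr0, zero_add, Finset.sum_eq_zero_iff_of_nonneg fun i _ => hnn i] at hcomp
    exact fun i => hcomp i (Finset.mem_univ i)
  have hpos : 0 < l none := by
    refine (hl0 none).lt_of_ne' fun h0 => hlne ?_
    have h1 := hrel (s - x)
    rw [h0, zero_mul] at h1
    have h2 : ∀ i, l (some (some i)) * L i (s - x) ≤ l (some (some i)) * (F i s - 1) := fun i => by
      nlinarith [mul_le_mul_of_nonneg_left (hsub i) (hl0 (some (some i))), hcomp' i]
    have h3 : ∀ i, l (some (some i)) * (F i s - 1) ≤ 0 := fun i =>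
      mul_nonpos_of_nonneg_of_nonpos (hl0 _) (sub_nonpos.2 (hs i).le)
    have h4 : ∀ i, l (some (some i)) * L i (s - x) = 0 := by
      rw [Finset.sum_eq_zero_iff_of_nonpos fun i _ => (h2 i).trans (h3 i)] at h1
      exact fun i => h1 i (Finset.mem_univ i)
    funext o
    match o with
    | none => exact h0
    | some none => exact hr0
    | some (some i) =>
      have h5 := h2 i
      rw [h4 i] at h5
      rcases mul_eq_zero.1 (le_antisymm (h3 i) h5) with h | h
      · exact h
      · linarith [hs i]
  refine ⟨fun i => l (some (some i)) / l none, fun i => div_nonneg (hl0 _) hpos.le,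
    fun i hi => ?_, fun v => ?_⟩
  · rcases mul_eq_zero.1 (hcomp' i) with h | h
    · simp [h]
    · linarith
  · have h1 := hrel v
    simp only [div_mul_eq_mul_div]
    rw [← Finset.sum_div, h1, mul_div_cancel_left₀ _ hpos.ne']

lemma exp_mul_le_quadratic {t : ℝ} (ht : |t| ≤ 1) (s : ℝ) :
    Real.exp (t * s) ≤ 1 + t * s + 2 * t ^ 2 * (Real.exp (2 * s) + Real.exp (-(2 * s))) := by
  have h1 := Complex.norm_exp_sub_sum_le_norm_mul_exp ((t * s : ℝ) : ℂ) 2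
  have h2 : Complex.exp ((t * s : ℝ) : ℂ) -
        ∑ m ∈ Finset.range 2, ((t * s : ℝ) : ℂ) ^ m / (m.factorial : ℂ)
      = ((Real.exp (t * s) - (1 + t * s) : ℝ) : ℂ) := by
    simp [Finset.sum_range_succ]
  rw [h2, Complex.norm_real, Complex.norm_real, Real.norm_eq_abs, Real.norm_eq_abs] at h1
  have h3 : Real.exp |t * s| ≤ Real.exp |s| := by
    rw [Real.exp_le_exp, abs_mul]
    exact mul_le_of_le_one_left (abs_nonneg _) ht
  have h4 : s ^ 2 ≤ 2 * Real.exp |s| := by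
    have := Real.quadratic_le_exp_of_nonneg (abs_nonneg s)
    rw [sq_abs] at this
    nlinarith [abs_nonneg s]
  have h5 : Real.exp |s| * Real.exp |s| ≤ Real.exp (2 * s) + Real.exp (-(2 * s)) := by
    rw [← Real.exp_add]
    rcases abs_cases s with ⟨h, -⟩ | ⟨h, -⟩ <;> rw [h]
    · rw [← two_mul]; linarith [Real.exp_pos (-(2 * s))]
    · rw [show -s + -s = -(2 * s) by ring]; linarith [Real.exp_pos (2 * s)]
  have h6 : |t * s| ^ 2 * Real.exp |t * s| ≤ t ^ 2 * (2 * Real.exp |s|) * Real.exp |s| := by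
    rw [sq_abs, mul_pow]
    gcongr
  have h7 := (abs_le.1 h1).2
  nlinarith [mul_le_mul_of_nonneg_left h5 (sq_nonneg t)]

lemma abs_le_exp_add_exp_neg (x : ℝ) : |x| ≤ Real.exp x + Real.exp (-x) := by
  rcases abs_cases x with ⟨h, -⟩ | ⟨h, -⟩ <;> rw [h]
  · linarith [Real.add_one_le_exp x, Real.exp_pos (-x)]
  · linarith [Real.add_one_le_exp (-x), Real.exp_pos x]

lemma dotZ_add (d : ℕ) (a b : Rd d) (z : Zd d) : dotZ d (a + b) z = dotZ d a z + dotZ d b z := by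
  simp only [dotZ, Prod.fst_add, Prod.snd_add, Pi.add_apply, add_mul, Finset.sum_add_distrib]
  ring

lemma dotZ_smul (d : ℕ) (t : ℝ) (a : Rd d) (z : Zd d) : dotZ d (t • a) z = t * dotZ d a z := by
  simp only [dotZ, Prod.smul_fst, Prod.smul_snd, Pi.smul_apply, smul_eq_mul, mul_add,
    Finset.mul_sum, mul_assoc]

/-- The scalar product with `q` as a linear functional. -/
noncomputable def dotLin (d : ℕ) (q : Rd d) : Rd d →ₗ[ℝ] ℝ where
  toFun := dotR d q
  map_add' v w := by
    simp only [dotR, Prod.fst_add, Prod.snd_add, Pi.add_apply, mul_add, Finset.sum_add_distrib]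
    ring
  map_smul' t v := by
    simp only [dotR, Prod.smul_fst, Prod.smul_snd, Pi.smul_apply, smul_eq_mul, mul_add,
      Finset.mul_sum, RingHom.id_apply]
    congr 1
    · exact Finset.sum_congr rfl fun i _ => by ring
    · ring

@[simp] lemma dotLin_apply (d : ℕ) (q v : Rd d) : dotLin d q v = dotR d q v := rfl

lemma dotR_comm (d : ℕ) (q v : Rd d) : dotR d q v = dotR d v q := by
  simp only [dotR, mul_comm]

lemma dotR_add_left (d : ℕ) (p q v : Rd d) : dotR d (p + q) v = dotR d p v + dotR d q v := by
  rw [dotR_comm, dotR_comm d p, dotR_comm d q]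
  exact (dotLin d v).map_add p q

lemma dotR_smul_left (d : ℕ) (t : ℝ) (q v : Rd d) : dotR d (t • q) v = t * dotR d q v := by
  rw [dotR_comm, dotR_comm d q]
  exact (dotLin d v).map_smul t q

lemma eq_of_dotR_eq (d : ℕ) {p q : Rd d} (h : ∀ v, dotR d p v = dotR d q v) : p = q := by
  refine Prod.ext (funext fun i => ?_) ?_
  · simpa [dotR, Pi.single_apply] using h (Pi.single i 1, 0)
  · simpa [dotR] using h (0, 1)

section GeneratingFunction

variable {d : ℕ} {μ : Zd d → ℝ}

lemma summable_mul_dotZ (hμ : ∀ z, 0 ≤ μ z)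
    (hS : ∀ a, Summable fun z => μ z * Real.exp (dotZ d a z)) (a v : Rd d) :
    Summable fun z => μ z * dotZ d v z * Real.exp (dotZ d a z) := by
  refine Summable.of_norm_bounded ((hS (a + v)).add (hS (a + (-1 : ℝ) • v))) fun z => ?_
  rw [Real.norm_eq_abs, abs_mul, abs_mul, abs_of_nonneg (hμ z), Real.abs_exp, dotZ_add, dotZ_add,
    dotZ_smul, Real.exp_add, Real.exp_add, neg_one_mul]
  have h := mul_le_mul_of_nonneg_left (abs_le_exp_add_exp_neg (dotZ d v z))
    (mul_nonneg (hμ z) (Real.exp_pos (dotZ d a z)).le)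
  nlinarith

lemma hasSum_dotR_jgfGrad (hμ : ∀ z, 0 ≤ μ z)
    (hS : ∀ a, Summable fun z => μ z * Real.exp (dotZ d a z)) (a v : Rd d) :
    HasSum (fun z => μ z * dotZ d v z * Real.exp (dotZ d a z)) (dotR d (jgfGrad d μ a) v) := by
  have h1 : ∀ i, HasSum (fun z : Zd d => μ z * (z.1 i : ℝ) * Real.exp (dotZ d a z))
      ((jgfGrad d μ a).1 i) := fun i => by
    have := summable_mul_dotZ hμ hS a (Pi.single i 1, 0)
    simp only [dotZ, Pi.single_apply, ite_mul, one_mul, zero_mul, Finset.sum_ite_eq',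
      Finset.mem_univ, if_true, add_zero] at this
    exact this.hasSum
  have h2 : HasSum (fun z : Zd d => μ z * (z.2 : ℝ) * Real.exp (dotZ d a z))
      ((jgfGrad d μ a).2) := by
    have := summable_mul_dotZ hμ hS a (0, 1)
    simp only [dotZ, Pi.zero_apply, zero_mul, Finset.sum_const_zero, one_mul, zero_add] at this
    exact this.hasSum
  have h3 := (hasSum_sum fun i (_ : i ∈ Finset.univ) => (h1 i).mul_right (v.1 i)).add
    (h2.mul_right v.2)
  refine (congrArg (HasSum · _) (funext fun z => ?_)).mpr h3
  simp only [dotZ, mul_add, add_mul, Finset.mul_sum, Finset.sum_mul]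
  congr 1
  · exact Finset.sum_congr rfl fun i _ => by ring
  · ring

/-- The gradient inequality for the jump generating function. -/
lemma jgf_add_dotR_le (hμ : ∀ z, 0 ≤ μ z)
    (hS : ∀ a, Summable fun z => μ z * Real.exp (dotZ d a z)) (a b : Rd d) :
    jgf d μ a + dotR d (jgfGrad d μ a) (b - a) ≤ jgf d μ b := by
  refine hasSum_le (fun z => ?_) ((hS a).hasSum.add (hasSum_dotR_jgfGrad hμ hS a (b - a)))
    (hS b).hasSum
  have h := mul_le_mul_of_nonneg_left (Real.add_one_le_exp (dotZ d (b - a) z))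
    (mul_nonneg (hμ z) (Real.exp_pos (dotZ d a z)).le)
  rw [mul_assoc (μ z) _ (Real.exp (dotZ d (b - a) z)), ← Real.exp_add, ← dotZ_add,
    add_sub_cancel] at h
  linarith

lemma jgf_add_dotR_lt (hμ : ∀ z, 0 ≤ μ z)
    (hS : ∀ a, Summable fun z => μ z * Real.exp (dotZ d a z)) (a b : Rd d) {z₀ : Zd d}
    (h0 : 0 < μ z₀) (hne : dotZ d (b - a) z₀ ≠ 0) :
    jgf d μ a + dotR d (jgfGrad d μ a) (b - a) < jgf d μ b := by
  refine hasSum_lt (i := z₀) (fun z => ?_) ?_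
    ((hS a).hasSum.add (hasSum_dotR_jgfGrad hμ hS a (b - a))) (hS b).hasSum
  · have h := mul_le_mul_of_nonneg_left (Real.add_one_le_exp (dotZ d (b - a) z))
      (mul_nonneg (hμ z) (Real.exp_pos (dotZ d a z)).le)
    rw [mul_assoc (μ z) _ (Real.exp (dotZ d (b - a) z)), ← Real.exp_add, ← dotZ_add,
      add_sub_cancel] at h
    show _ + _ ≤ _
    linarith
  · have h := mul_lt_mul_of_pos_left (Real.add_one_lt_exp hne)
      (mul_pos h0 (Real.exp_pos (dotZ d a z₀)))
    rw [mul_assoc (μ z₀) _ (Real.exp (dotZ d (b - a) z₀)), ← Real.exp_add, ← dotZ_add,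
      add_sub_cancel] at h
    show _ + _ < _
    linarith

lemma jgf_add_smul_le (hμ : ∀ z, 0 ≤ μ z)
    (hS : ∀ a, Summable fun z => μ z * Real.exp (dotZ d a z)) (a v : Rd d) {t : ℝ}
    (ht : |t| ≤ 1) :
    jgf d μ (a + t • v) ≤ jgf d μ a + t * dotR d (jgfGrad d μ a) v +
      2 * (jgf d μ (a + (2 : ℝ) • v) + jgf d μ (a + (-2 : ℝ) • v)) * t ^ 2 := by
  refine hasSum_le (fun z => ?_) (hS _).hasSum
    (((hS a).hasSum.add ((hasSum_dotR_jgfGrad hμ hS a v).mul_left t)).add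
      ((((hS (a + (2 : ℝ) • v)).hasSum.add (hS (a + (-2 : ℝ) • v)).hasSum).mul_left 2).mul_right
        (t ^ 2)))
  have h := mul_le_mul_of_nonneg_left (exp_mul_le_quadratic ht (dotZ d v z))
    (mul_nonneg (hμ z) (Real.exp_pos (dotZ d a z)).le)
  simp only [dotZ_add, dotZ_smul, Real.exp_add, neg_mul]
  linarith

lemma continuous_jgf_snd (hμ : ∀ z, 0 ≤ μ z)
    (hS : ∀ a, Summable fun z => μ z * Real.exp (dotZ d a z)) (α : Fin (d - 1) → ℝ) :
    Continuous fun β : ℝ => jgf d μ (α, β) := by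
  rw [continuous_iff_continuousAt]
  intro β
  have hsub : Tendsto (fun β' : ℝ => β' - β) (𝓝 β) (𝓝 0) := by
    have : ContinuousAt (fun β' : ℝ => β' - β) β := by fun_prop
    simpa using this.tendsto
  have hpt : ∀ β' : ℝ, ((α, β) : Rd d) + (β' - β) • ((0, 1) : Rd d) = (α, β') := fun β' => by
    ext <;> simp
  let f : ℝ → ℝ := fun t => jgf d μ (α, β) + t * dotR d (jgfGrad d μ (α, β)) (0, 1)
  let C := 2 * (jgf d μ ((α, β) + (2 : ℝ) • ((0, 1) : Rd d)) +
    jgf d μ ((α, β) + (-2 : ℝ) • ((0, 1) : Rd d)))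
  have hf : Tendsto f (𝓝 0) (𝓝 (jgf d μ (α, β))) := by
    have : ContinuousAt f 0 := by fun_prop
    simpa [f] using this.tendsto
  have hg : Tendsto (fun t => f t + C * t ^ 2) (𝓝 0) (𝓝 (jgf d μ (α, β))) := by
    have : ContinuousAt (fun t => f t + C * t ^ 2) 0 := by fun_prop
    simpa [f] using this.tendsto
  refine tendsto_of_tendsto_of_tendsto_of_le_of_le' (hf.comp hsub) (hg.comp hsub)
    (Eventually.of_forall fun β' => ?_) ?_
  · have h := jgf_add_dotR_le hμ hS (α, β) ((α, β) + (β' - β) • ((0, 1) : Rd d))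
    rw [add_sub_cancel_left, dotR_comm, dotR_smul_left, dotR_comm, hpt] at h
    exact h
  · have hev : ∀ᶠ β' : ℝ in 𝓝 β, |β' - β| < 1 := Metric.ball_mem_nhds β one_pos
    filter_upwards [hev] with β' hβ'
    have h := jgf_add_smul_le hμ hS (α, β) (0, 1) hβ'.le
    rw [hpt] at h
    exact h

lemma mul_exp_le_jgf (hμ : ∀ z, 0 ≤ μ z)
    (hS : ∀ a, Summable fun z => μ z * Real.exp (dotZ d a z)) (a : Rd d) (z : Zd d) :
    μ z * Real.exp (dotZ d a z) ≤ jgf d μ a :=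
  (hS a).le_tsum z fun w _ => mul_nonneg (hμ w) (Real.exp_pos _).le

lemma jgf_nonneg (hμ : ∀ z, 0 ≤ μ z) (a : Rd d) : 0 ≤ jgf d μ a :=
  tsum_nonneg fun z => mul_nonneg (hμ z) (Real.exp_pos _).le

/-- Along vertical lines the jump generating function is coercive as soon as the walk can jump
both up and down. -/
lemma tendsto_jgf_snd_cocompact (hμ : ∀ z, 0 ≤ μ z)
    (hS : ∀ a, Summable fun z => μ z * Real.exp (dotZ d a z))
    (hup : ∃ z : Zd d, 0 < z.2 ∧ 0 < μ z) (hdown : ∃ z : Zd d, z.2 < 0 ∧ 0 < μ z)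
    (α : Fin (d - 1) → ℝ) : Tendsto (fun β : ℝ => jgf d μ (α, β)) (cocompact ℝ) atTop := by
  rw [cocompact_eq_atBot_atTop, tendsto_sup]
  constructor
  · obtain ⟨z, hz, hzμ⟩ := hdown
    refine tendsto_atTop_mono (fun β => mul_exp_le_jgf hμ hS (α, β) z) ?_
    refine (Real.tendsto_exp_atTop.comp ?_).const_mul_atTop hzμ
    have hz' : (z.2 : ℝ) < 0 := by exact_mod_cast hz
    exact tendsto_atTop_add_const_left _ (∑ i, α i * (z.1 i : ℝ))
      (tendsto_id.atBot_mul_const_of_neg hz')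
  · obtain ⟨z, hz, hzμ⟩ := hup
    refine tendsto_atTop_mono (fun β => mul_exp_le_jgf hμ hS (α, β) z) ?_
    refine (Real.tendsto_exp_atTop.comp ?_).const_mul_atTop hzμ
    have hz' : (0 : ℝ) < z.2 := by exact_mod_cast hz
    exact tendsto_atTop_add_const_left _ (∑ i, α i * (z.1 i : ℝ))
      (tendsto_id.atTop_mul_const hz')

lemma jgfGrad_zero : jgfGrad d μ 0 = meanVec d μ := by
  simp [jgfGrad, jgfDβ, meanVec, dotZ]

lemma jgf_zero (h : HasSum μ 1) : jgf d μ 0 = 1 := by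
  simp [jgf, dotZ, h.tsum_eq]

/-- A zero of `∂φ/∂β` is the strict minimum of `φ` on its vertical line. -/
lemma eq_of_jgf_le_of_jgfDβ_eq_zero (hμ : ∀ z, 0 ≤ μ z)
    (hS : ∀ a, Summable fun z => μ z * Real.exp (dotZ d a z))
    (hup : ∃ z : Zd d, 0 < z.2 ∧ 0 < μ z) {a b : Rd d} (h1 : a.1 = b.1)
    (hb : jgfDβ d μ b = 0) (hle : jgf d μ a ≤ jgf d μ b) : a = b := by
  obtain ⟨z, hz, hzμ⟩ := hup
  by_contra hne
  have h2 : a.2 - b.2 ≠ 0 := fun h => hne (Prod.ext h1 (sub_eq_zero.1 h))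
  have hab : a - b = (0, a.2 - b.2) := Prod.ext (by simp [h1]) rfl
  have h := jgf_add_dotR_lt hμ hS b a hzμ (by
    rw [hab]
    simpa [dotZ] using ⟨h2, hz.ne'⟩)
  rw [hab] at h
  simp [dotR, jgfGrad, hb] at h
  linarith

end GeneratingFunction

lemma kerIter_invariant {S : Type*} [DecidableEq S] (p : S → S → ℝ≥0∞) (P : S → Prop)
    (hp : ∀ z w, P z → p z w ≠ 0 → P w) (n : ℕ) {z w : S} (hz : P z)
    (h : kerIter p n z w ≠ 0) : P w := by
  induction n generalizing w with
  | zero =>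
    simp only [kerIter, ne_eq, ite_eq_right_iff, one_ne_zero, imp_false, not_not] at h
    exact h ▸ hz
  | succ n ih =>
    simp only [kerIter, ne_eq, ENNReal.tsum_eq_zero, mul_eq_zero, not_forall, not_or] at h
    obtain ⟨v, hv, hvw⟩ := h
    exact hp v w (ih hv) hvw

lemma exists_pos_jump_up {d : ℕ} {μ : Zd d → ℝ} (h : H2 d μ) :
    ∃ z : Zd d, 0 < z.2 ∧ 0 < μ z := by
  by_contra! hc
  obtain ⟨n, hn⟩ := h.1 0 (0, 1)
  have := kerIter_invariant (stepS d μ) (fun z => z.2 ≤ 0) (fun z w hz hw => by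
    by_contra! hlt
    exact hw (ENNReal.ofReal_of_nonpos (hc (w - z) (by simp; omega)))) n (by simp) hn.ne'
  simp at this

lemma exists_pos_jump_down {d : ℕ} {μ : Zd d → ℝ} (h : H2 d μ) :
    ∃ z : Zd d, z.2 < 0 ∧ 0 < μ z := by
  by_contra! hc
  obtain ⟨n, hn⟩ := h.1 0 (0, -1)
  have := kerIter_invariant (stepS d μ) (fun z => 0 ≤ z.2) (fun z w hz hw => by
    by_contra! hlt
    exact hw (ENNReal.ofReal_of_nonpos (hc (w - z) (by simp; omega)))) n (by simp) hn.ne'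
  simp at this

lemma exists_pos_boundary_jump_up {d : ℕ} {μ μ0 : Zd d → ℝ} (h : H1 d μ μ0) :
    ∃ z : Zd d, 0 < z.2 ∧ 0 < μ0 z := by
  by_contra! hc
  obtain ⟨n, hn⟩ := h 0 (0, 1)
  have := kerIter_invariant (step d μ μ0) (fun z => z.2 = 0) (fun z w hz hw => by
    by_contra hne
    refine hw ?_
    rw [step, if_pos hz]
    exact ENNReal.ofReal_of_nonpos (hc _ (by simp [toZ, hz]; omega))) n (by simp) hn.ne'
  simp at this

lemma jgfDβ_pos {d : ℕ} {μ0 : Zd d → ℝ} (hμ : ∀ z, 0 ≤ μ0 z)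
    (hS : ∀ a, Summable fun z => μ0 z * Real.exp (dotZ d a z))
    (hneg : ∀ z : Zd d, z.2 < 0 → μ0 z = 0) (hup : ∃ z : Zd d, 0 < z.2 ∧ 0 < μ0 z) (a : Rd d) :
    0 < jgfDβ d μ0 a := by
  obtain ⟨z, hz, hzμ⟩ := hup
  have hsum := summable_mul_dotZ hμ hS a (0, 1)
  simp only [dotZ, Pi.zero_apply, zero_mul, Finset.sum_const_zero, one_mul, zero_add] at hsum
  refine hsum.tsum_pos (fun w => ?_) z ?_
  · rcases lt_or_ge w.2 0 with hw | hw
    · simp [hneg w hw]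
    · have : (0 : ℝ) ≤ w.2 := by exact_mod_cast hw
      have := hμ w
      positivity
  · have : (0 : ℝ) < z.2 := by exact_mod_cast hz
    positivity

/-- A nontrivial relation with nonnegative coefficients between the means is excluded by the
assumption that they do not point in opposite directions. -/
lemma exists_dotR_meanVec_neg {d : ℕ} {μ μ0 : Zd d → ℝ} (h : H3 d μ μ0) :
    ∃ v, dotR d (meanVec d μ) v < 0 ∧ dotR d (meanVec d μ0) v < 0 := by
  obtain ⟨hm, hm0, hne⟩ := h
  by_contra hv
  obtain ⟨l, hl, hl0, hrel⟩ := exists_nonneg_relation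
    ![dotLin d (meanVec d μ), dotLin d (meanVec d μ0)] (by
      rintro ⟨v, hlt⟩
      exact hv ⟨v, hlt 0, hlt 1⟩)
  have hsum : l 0 • meanVec d μ + l 1 • meanVec d μ0 = 0 := by
    refine eq_of_dotR_eq d fun v => ?_
    rw [dotR_add_left, dotR_smul_left, dotR_smul_left]
    have := hrel v
    simp only [Fin.sum_univ_two] at this
    simpa [dotR] using this
  have hnorm : l 0 * ‖meanVec d μ‖ = l 1 * ‖meanVec d μ0‖ := by
    have := congrArg norm (eq_neg_of_add_eq_zero_left hsum)
    rwa [norm_neg, norm_smul, norm_smul, Real.norm_of_nonneg (hl 0),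
      Real.norm_of_nonneg (hl 1)] at this
  have hp := norm_pos_iff.2 hm
  have hp0 := norm_pos_iff.2 hm0
  have h0 : l 0 ≠ 0 := by
    intro h0
    refine hl0 (funext fun i => ?_)
    rw [h0, zero_mul, eq_comm, mul_eq_zero] at hnorm
    fin_cases i
    · exact h0
    · exact hnorm.resolve_right hp0.ne'
  refine hne ?_
  have hc : (l 0 * ‖meanVec d μ‖) • (‖meanVec d μ‖⁻¹ • meanVec d μ +
      ‖meanVec d μ0‖⁻¹ • meanVec d μ0) = 0 := by
    rw [smul_add, smul_smul, smul_smul, mul_assoc, mul_inv_cancel₀ hp.ne', hnorm, mul_assoc,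
      mul_inv_cancel₀ hp0.ne', mul_one, mul_one, hsum]
  exact (smul_eq_zero.1 hc).resolve_left (mul_ne_zero h0 hp.ne')

lemma eventually_jgf_smul_lt_one {d : ℕ} {μ : Zd d → ℝ} (hμ : IsProb d μ)
    (hS : ∀ a, Summable fun z => μ z * Real.exp (dotZ d a z)) {v : Rd d}
    (hv : dotR d (meanVec d μ) v < 0) : ∀ᶠ t : ℝ in 𝓝[>] 0, jgf d μ (t • v) < 1 := by
  set C := 2 * (jgf d μ (0 + (2 : ℝ) • v) + jgf d μ (0 + (-2 : ℝ) • v)) with hC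
  have h1 : ∀ᶠ t : ℝ in 𝓝[>] 0, t < 1 :=
    (eventually_lt_nhds one_pos).filter_mono nhdsWithin_le_nhds
  have h2 : ∀ᶠ t : ℝ in 𝓝[>] 0, C * t < -dotR d (meanVec d μ) v := by
    have : Tendsto (fun t : ℝ => C * t) (𝓝[>] 0) (𝓝 0) := by
      have : ContinuousAt (fun t : ℝ => C * t) 0 := by fun_prop
      simpa using this.tendsto.mono_left nhdsWithin_le_nhds
    exact this.eventually (Iio_mem_nhds (neg_pos.2 hv))
  filter_upwards [h1, h2, self_mem_nhdsWithin] with t h1 h2 h0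
  have h0 : 0 < t := h0
  have h3 := jgf_add_smul_le hμ.1 hS 0 v (abs_le.2 ⟨by linarith, h1.le⟩)
  rw [jgf_zero hμ.2, jgfGrad_zero, zero_add, ← hC] at h3
  nlinarith [mul_lt_mul_of_pos_left h2 h0]

/-- The constraints `φ ≤ 1` and `φ₀ ≤ 1` admit a common strictly feasible point. -/
lemma exists_jgf_lt_one {d : ℕ} {μ μ0 : Zd d → ℝ} (hμ : IsProb d μ) (hμ0 : IsProb d μ0)
    (hH3 : H3 d μ μ0) (hH4 : H4 d μ μ0) : ∃ s, jgf d μ s < 1 ∧ jgf d μ0 s < 1 := by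
  obtain ⟨v, hv, hv0⟩ := exists_dotR_meanVec_neg hH3
  obtain ⟨t, ht⟩ := ((eventually_jgf_smul_lt_one hμ (fun a => (hH4 a).1) hv).and
    (eventually_jgf_smul_lt_one hμ0 (fun a => (hH4 a).2) hv0)).exists
  exact ⟨t • v, ht⟩

/-- The infimum defining `Θ` is attained. -/
lemma mem_Theta_iff {d : ℕ} {μ μ0 : Zd d → ℝ} (hμ : IsProb d μ) (hμ0 : IsProb d μ0)
    (hH2 : H2 d μ) (hH4 : H4 d μ μ0) (α : Fin (d - 1) → ℝ) :
    α ∈ Theta d μ μ0 ↔ ∃ β : ℝ, jgf d μ (α, β) ≤ 1 ∧ jgf d μ0 (α, β) ≤ 1 := by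
  have hcont := (continuous_jgf_snd hμ.1 (fun a => (hH4 a).1) α).max
    (continuous_jgf_snd hμ0.1 (fun a => (hH4 a).2) α)
  have htend := tendsto_atTop_mono (fun β => le_max_left (jgf d μ (α, β)) (jgf d μ0 (α, β)))
    (tendsto_jgf_snd_cocompact hμ.1 (fun a => (hH4 a).1) (exists_pos_jump_up hH2)
      (exists_pos_jump_down hH2) α)
  constructor
  · intro h
    obtain ⟨β, hβ⟩ := hcont.exists_forall_le htend
    exact ⟨β, max_le_iff.1 ((le_ciInf hβ).trans h)⟩
  · rintro ⟨β, hβ⟩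
    change (⨅ β : ℝ, max (jgf d μ (α, β)) (jgf d μ0 (α, β))) ≤ 1
    refine ciInf_le_of_le ⟨0, ?_⟩ β (max_le hβ.1 hβ.2)
    rintro _ ⟨β', rfl⟩
    exact (jgf_nonneg hμ.1 _).trans (le_max_left _ _)

/-- Multipliers for a normal vector of `D̂`, seen as the projection of the set of all
`(α, β, β')` with `φ(α, β) ≤ 1`, `φ(α, β') ≤ 1` and `φ₀(α, β') ≤ 1`. -/
lemma exists_multipliers_of_mem_normalCone {d : ℕ} {μ μ0 : Zd d → ℝ} (hμ : IsProb d μ)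
    (hμ0 : IsProb d μ0) (hH2 : H2 d μ) (hH3 : H3 d μ μ0) (hH4 : H4 d μ μ0) {a abar q : Rd d}
    (ha : jgf d μ a ≤ 1) (hbar : jgf d μ abar ≤ 1) (hbar0 : jgf d μ0 abar ≤ 1)
    (h1 : abar.1 = a.1) (hq : q ∈ normalCone d (Dhat d μ μ0) a) :
    ∃ l₀ l₁ l₂ : ℝ, 0 ≤ l₀ ∧ 0 ≤ l₁ ∧ 0 ≤ l₂ ∧ (jgf d μ a < 1 → l₀ = 0) ∧
      (jgf d μ0 abar < 1 → l₂ = 0) ∧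
      q = l₀ • jgfGrad d μ a + l₁ • jgfGrad d μ abar + l₂ • jgfGrad d μ0 abar ∧
      l₁ * jgfDβ d μ abar + l₂ * jgfDβ d μ0 abar = 0 := by
  have hS := fun a => (hH4 a).1
  have hS0 := fun a => (hH4 a).2
  obtain ⟨s, hs, hs0⟩ := exists_jgf_lt_one hμ hμ0 hH3 hH4
  let P : Rd d × ℝ →ₗ[ℝ] Rd d := LinearMap.fst ℝ (Rd d) ℝ
  let Q : Rd d × ℝ →ₗ[ℝ] Rd d :=
    (LinearMap.fst ℝ _ _ ∘ₗ LinearMap.fst ℝ (Rd d) ℝ).prod (LinearMap.snd ℝ (Rd d) ℝ)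
  let x : Rd d × ℝ := (a, abar.2)
  have hQx : Q x = abar := Prod.ext h1.symm rfl
  have hQs : Q (s, s.2) = s := rfl
  obtain ⟨l, hl, hl0, hrel⟩ := exists_multipliers
    ![fun y => jgf d μ (P y), fun y => jgf d μ (Q y), fun y => jgf d μ0 (Q y)]
    ![dotLin d (jgfGrad d μ a) ∘ₗ P, dotLin d (jgfGrad d μ abar) ∘ₗ Q,
      dotLin d (jgfGrad d μ0 abar) ∘ₗ Q] (dotLin d q ∘ₗ P) x (s, s.2)
    (by
      intro i
      fin_cases i
      · exact ha
      · exact (congrArg (jgf d μ) hQx).le.trans hbar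
      · exact (congrArg (jgf d μ0) hQx).le.trans hbar0)
    (by
      intro i
      fin_cases i
      · exact hs
      · exact hs
      · exact hs0)
    (by
      intro i
      fin_cases i
      · exact jgf_add_dotR_le hμ.1 hS a s
      · have h := jgf_add_dotR_le hμ.1 hS abar s
        rw [← dotLin_apply, map_sub] at h
        simpa [map_sub, hQx, hQs] using h
      · have h := jgf_add_dotR_le hμ0.1 hS0 abar s
        rw [← dotLin_apply, map_sub] at h
        simpa [map_sub, hQx, hQs] using h)
    (by
      intro i v
      fin_cases i
      · exact ⟨_, fun t ht => jgf_add_smul_le hμ.1 hS a (P v) ht⟩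
      · refine ⟨2 * (jgf d μ (abar + (2 : ℝ) • Q v) + jgf d μ (abar + (-2 : ℝ) • Q v)),
          fun t ht => ?_⟩
        simpa [hQx] using jgf_add_smul_le hμ.1 hS abar (Q v) ht
      · refine ⟨2 * (jgf d μ0 (abar + (2 : ℝ) • Q v) + jgf d μ0 (abar + (-2 : ℝ) • Q v)),
          fun t ht => ?_⟩
        simpa [hQx] using jgf_add_smul_le hμ0.1 hS0 abar (Q v) ht)
    (by
      intro y hy
      exact hq y.1 ⟨(mem_Theta_iff hμ hμ0 hH2 hH4 _).2 ⟨y.2, hy 1, hy 2⟩, hy 0⟩)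
  simp only [Fin.sum_univ_three] at hrel
  refine ⟨l 0, l 1, l 2, hl 0, hl 1, hl 2, hl0 0,
    fun h => hl0 2 ((congrArg (jgf d μ0) hQx).trans_lt h),
    eq_of_dotR_eq d fun v => ?_, ?_⟩
  · have h := hrel (v, v.2)
    rw [dotR_add_left, dotR_add_left, dotR_smul_left, dotR_smul_left, dotR_smul_left]
    exact h
  · have h := hrel (0, 1)
    simp [P, Q, dotR, jgfGrad] at h
    linarith

lemma dotR_jgfGrad_sub_nonpos {d : ℕ} {μ : Zd d → ℝ} (hμ : ∀ z, 0 ≤ μ z)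
    (hS : ∀ a, Summable fun z => μ z * Real.exp (dotZ d a z)) {a b : Rd d}
    (ha : jgf d μ a = 1) (hb : jgf d μ b ≤ 1) : dotR d (jgfGrad d μ a) (b - a) ≤ 0 := by
  linarith [jgf_add_dotR_le hμ hS a b]

/-- The vector `∇φ₀(ā) + κ_ā ∇φ(ā)` is normal to `D̂`. -/
lemma dotR_boundary_normal_nonpos {d : ℕ} {μ μ0 : Zd d → ℝ} (hμ : IsProb d μ)
    (hμ0 : IsProb d μ0) (hH2 : H2 d μ) (hH4 : H4 d μ μ0) {a abar b : Rd d}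
    (hbar : jgf d μ abar = 1) (hbar0 : jgf d μ0 abar = 1) (h1 : abar.1 = a.1)
    (hneg : jgfDβ d μ abar < 0) (hpos : 0 ≤ jgfDβ d μ0 abar) (hb : b ∈ Dhat d μ μ0) :
    dotR d (jgfGrad d μ0 abar +
      (-(jgfDβ d μ0 abar) * (jgfDβ d μ abar)⁻¹) • jgfGrad d μ abar) (b - a) ≤ 0 := by
  obtain ⟨β, hβ, hβ0⟩ := (mem_Theta_iff hμ hμ0 hH2 hH4 _).1 hb.1
  set κ := -(jgfDβ d μ0 abar) * (jgfDβ d μ abar)⁻¹ with hκ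
  have hκ0 : 0 ≤ κ := mul_nonneg_of_nonpos_of_nonpos (by linarith) (inv_nonpos.2 hneg.le)
  have hκ1 : κ * jgfDβ d μ abar = -jgfDβ d μ0 abar := by
    rw [hκ, inv_mul_cancel_right₀ hneg.ne]
  have h2 := dotR_jgfGrad_sub_nonpos hμ.1 (fun a => (hH4 a).1) hbar hβ
  have h3 := dotR_jgfGrad_sub_nonpos hμ0.1 (fun a => (hH4 a).2) hbar0 hβ0
  have h4 := mul_nonpos_of_nonneg_of_nonpos hκ0 h2
  rw [dotR_add_left, dotR_smul_left]
  simp only [dotR, jgfGrad, Prod.fst_sub, Prod.snd_sub, h1, mul_add] at h3 h4 ⊢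
  have h5 : ∀ r, jgfDβ d μ0 abar * r + κ * (jgfDβ d μ abar * r) = 0 := fun r => by
    rw [← mul_assoc, hκ1]; ring
  linarith [h5 (b.2 - a.2), h5 (β - abar.2)]

/-- If `ā ∉ ∂₀D`, the multiplier of `∇φ(ā)` is determined by that of `∇φ₀(ā)`. -/
lemma smul_add_smul_eq_smul_boundary_normal {d : ℕ} {μ μ0 : Zd d → ℝ} {abar : Rd d} {l₁ l₂ : ℝ}
    (hne : jgfDβ d μ abar ≠ 0) (h : l₁ * jgfDβ d μ abar + l₂ * jgfDβ d μ0 abar = 0) :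
    l₁ • jgfGrad d μ abar + l₂ • jgfGrad d μ0 abar =
      l₂ • (jgfGrad d μ0 abar +
        (-(jgfDβ d μ0 abar) * (jgfDβ d μ abar)⁻¹) • jgfGrad d μ abar) := by
  have h1 : l₁ = l₂ * (-(jgfDβ d μ0 abar) * (jgfDβ d μ abar)⁻¹) := by
    field_simp
    linarith
  rw [smul_add, smul_smul, ← h1, add_comm]

/-- explicit description of the normal cone `V(a)` to `D̂` at a point
`a ∈ ∂D̂`, with `κ_ā = -(∂φ₀/∂β)(ā)·((∂φ/∂β)(ā))⁻¹`. -/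
theorem normal_cone_formula
    (d : ℕ) (hd : 2 ≤ d) (μ μ0 : Zd d → ℝ)
    (hμ : IsProb d μ) (hμ0 : IsProb d μ0)
    (hH0 : H0 d μ μ0) (hH1 : H1 d μ μ0) (hH2 : H2 d μ)
    (hH3 : H3 d μ μ0) (hH4 : H4 d μ μ0)
    (a abar : Rd d) (ha : a ∈ Dhat d μ μ0)
    (habar : abar ∈ bdMinus d μ ∧ abar.1 = a.1)
    (hbd : max (jgf d μ a) (jgf d μ0 abar) = 1) :
    (jgf d μ a = 1 ∧ jgf d μ0 abar = 1 ∧ a ∉ bdZero d μ →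
      normalCone d (Dhat d μ μ0) a =
        {q : Rd d | ∃ c₁ c₂ : ℝ, 0 ≤ c₁ ∧ 0 ≤ c₂ ∧
          q = c₁ • jgfGrad d μ a +
              c₂ • (jgfGrad d μ0 abar +
                (-(jgfDβ d μ0 abar) * (jgfDβ d μ abar)⁻¹) • jgfGrad d μ abar)}) ∧
    (jgf d μ a < 1 ∧ jgf d μ0 abar = 1 ∧ a ∉ bdZero d μ →
      normalCone d (Dhat d μ μ0) a =
        {q : Rd d | ∃ c : ℝ, 0 ≤ c ∧
          q = c • (jgfGrad d μ0 abar +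
            (-(jgfDβ d μ0 abar) * (jgfDβ d μ abar)⁻¹) • jgfGrad d μ abar)}) ∧
    (a ∈ bdZero d μ ∨ (jgf d μ0 abar < 1 ∧ jgf d μ a = 1) →
      normalCone d (Dhat d μ μ0) a =
        {q : Rd d | ∃ c : ℝ, 0 ≤ c ∧ q = c • jgfGrad d μ a}) := by
  have hS := fun a => (hH4 a).1
  have hS0 := fun a => (hH4 a).2
  obtain ⟨⟨hbar, hbarneg⟩, h1⟩ := habar
  have haφ : jgf d μ a ≤ 1 := ha.2
  have hbar0 : jgf d μ0 abar ≤ 1 := (le_max_right _ _).trans hbd.le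
  have hup := exists_pos_jump_up hH2
  have hpos : 0 < jgfDβ d μ0 abar :=
    jgfDβ_pos hμ0.1 hS0 hH0.2 (exists_pos_boundary_jump_up hH1) abar
  have heq : jgfDβ d μ abar = 0 → a = abar := fun h =>
    eq_of_jgf_le_of_jgfDβ_eq_zero hμ.1 hS hup h1.symm h (haφ.trans hbar.ge)
  have hlt : a ∉ bdZero d μ → jgfDβ d μ abar < 0 := fun h =>
    hbarneg.lt_of_ne fun h0 => h (heq h0 ▸ ⟨hbar, h0⟩)
  have hmul := fun q (hq : q ∈ normalCone d (Dhat d μ μ0) a) =>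
    exists_multipliers_of_mem_normalCone hμ hμ0 hH2 hH3 hH4 haφ hbar.le hbar0 h1 hq
  refine ⟨fun ⟨haeq, hbar0eq, hnot⟩ => ?_, fun ⟨halt, hbar0eq, hnot⟩ => ?_, fun hcase => ?_⟩
  · ext q
    constructor
    · intro hq
      obtain ⟨l₀, l₁, l₂, hl₀, -, hl₂, -, -, hqe, hrel⟩ := hmul q hq
      exact ⟨l₀, l₂, hl₀, hl₂, by
        rw [hqe, add_assoc, smul_add_smul_eq_smul_boundary_normal (hlt hnot).ne hrel]⟩
    · rintro ⟨c₁, c₂, hc₁, hc₂, rfl⟩ b hb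
      rw [dotR_add_left, dotR_smul_left, dotR_smul_left d c₂]
      exact add_nonpos
        (mul_nonpos_of_nonneg_of_nonpos hc₁ (dotR_jgfGrad_sub_nonpos hμ.1 hS haeq hb.2))
        (mul_nonpos_of_nonneg_of_nonpos hc₂ (dotR_boundary_normal_nonpos hμ hμ0 hH2 hH4 hbar
          hbar0eq h1 (hlt hnot) hpos.le hb))
  · ext q
    constructor
    · intro hq
      obtain ⟨l₀, l₁, l₂, -, -, hl₂, hl₀, -, hqe, hrel⟩ := hmul q hq
      exact ⟨l₂, hl₂, by
        rw [hqe, hl₀ halt, zero_smul, zero_add,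
          smul_add_smul_eq_smul_boundary_normal (hlt hnot).ne hrel]⟩
    · rintro ⟨c, hc, rfl⟩ b hb
      rw [dotR_smul_left]
      exact mul_nonpos_of_nonneg_of_nonpos hc (dotR_boundary_normal_nonpos hμ hμ0 hH2 hH4 hbar
        hbar0eq h1 (hlt hnot) hpos.le hb)
  · have haeq : jgf d μ a = 1 := hcase.elim (fun h => h.1) fun h => h.2
    ext q
    constructor
    · intro hq
      obtain ⟨l₀, l₁, l₂, hl₀, hl₁, hl₂, -, hl₂0, hqe, hrel⟩ := hmul q hq
      by_cases h0 : jgfDβ d μ abar = 0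
      · have hl2 : l₂ = 0 := by
          rw [h0, mul_zero, zero_add] at hrel
          exact (mul_eq_zero.1 hrel).resolve_right hpos.ne'
        exact ⟨l₀ + l₁, add_nonneg hl₀ hl₁, by
          rw [hqe, hl2, zero_smul, add_zero, ← heq h0, add_smul]⟩
      · have hl2 : l₂ = 0 := by
          rcases hcase with h | h
          · have := eq_of_jgf_le_of_jgfDβ_eq_zero hμ.1 hS hup h1 h.2 (hbar.trans h.1.symm).le
            exact absurd (this ▸ h.2) h0
          · exact hl₂0 h.1
        have hl1 : l₁ = 0 := by
          rw [hl2, zero_mul, add_zero] at hrel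
          exact (mul_eq_zero.1 hrel).resolve_right h0
        exact ⟨l₀, hl₀, by rw [hqe, hl1, hl2, zero_smul, zero_smul, add_zero, add_zero]⟩
    · rintro ⟨c, hc, rfl⟩ b hb
      rw [dotR_smul_left]
      exact mul_nonpos_of_nonneg_of_nonpos hc (dotR_jgfGrad_sub_nonpos hμ.1 hS haeq hb.2)

end ReflectedRW
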